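/- There exists n₀ such that if G is an oriented graph on n ≥ n₀ vertices with minimum semidegree δ±(G) ≥ n/4 + 1/2 that contains no directed cycle of length 6, then G contains no transitive triangle; that is, there do not exist three distinct vertices a, b, c of G with edges ab, bc and ac. -/

import Mathlib

/-- The outdegree of a vertex `v` in the directed graph with edge relation `E`. -/
noncomputable def outDeg {n : ℕ} (E : Fin n → Fin n → Prop) (v : Fin n) : ℕ :=
  {w | E v w}.ncard

/-- The indegree of a vertex `v` in the directed graph with edge relation `E`. -/
noncomputable def inDeg {n : ℕ} (E : Fin n → Fin n → Prop) (v : Fin n) : ℕ :=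
  {w | E w v}.ncard

/-- The semidegree of a vertex: the minimum of its outdegree and indegree. -/
noncomputable def semiDeg {n : ℕ} (E : Fin n → Fin n → Prop) (v : Fin n) : ℕ :=
  min (outDeg E v) (inDeg E v)

/-- `E` is an oriented graph: no loops and no pair of opposite edges. -/
def Oriented {n : ℕ} (E : Fin n → Fin n → Prop) : Prop :=
  (∀ v, ¬ E v v) ∧ (∀ u v, E u v → ¬ E v u)

/-- The graph contains a directed cycle of length exactly `t`:
`t` distinct vertices cyclically joined by edges. -/
def HasDiCycle {n : ℕ} (E : Fin n → Fin n → Prop) (t : ℕ) : Prop :=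
  ∃ v : ZMod t → Fin n, Function.Injective v ∧ ∀ i, E (v i) (v (i + 1))

/-- The graph contains a closed directed walk of length `t` (vertices may repeat). -/
def HasClosedWalk {n : ℕ} (E : Fin n → Fin n → Prop) (t : ℕ) : Prop :=
  ∃ w : ℕ → Fin n, w 0 = w t ∧ ∀ i < t, E (w i) (w (i + 1))

/-- There is a directed path of length `t` from `x` to `y` (all vertices distinct). -/
def HasPath {n : ℕ} (E : Fin n → Fin n → Prop) (x y : Fin n) (t : ℕ) : Prop :=
  ∃ u : Fin (t + 1) → Fin n, Function.Injective u ∧ u 0 = x ∧ u (Fin.last t) = y ∧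
    ∀ i : Fin t, E (u i.castSucc) (u i.succ)

/-- The graph contains an `s`-shortcut: a directed path `v₀ v₁ ⋯ v_s` on distinct
vertices together with the additional edge `v₀ v_s`. -/
def HasShortcut {n : ℕ} (E : Fin n → Fin n → Prop) (s : ℕ) : Prop :=
  ∃ v : Fin (s + 1) → Fin n, Function.Injective v ∧
    (∀ i : Fin s, E (v i.castSucc) (v i.succ)) ∧ E (v 0) (v (Fin.last s))

/-- The graph is homomorphic to the directed cycle `C_k`. -/
def HomToCycle {n : ℕ} (E : Fin n → Fin n → Prop) (k : ℕ) : Prop :=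
  ∃ f : Fin n → ZMod k, ∀ u v, E u v → f v = f u + 1

namespace SemidegreeC6

open Finset
open scoped Classical

section

variable {V : Type*}

/-- A relation without closed walks of lengths one, two, three and six. -/
structure Clean (E : V → V → Prop) : Prop where
  no_one : ∀ a, ¬ E a a
  no_two : ∀ a b, E a b → ¬ E b a
  no_three : ∀ a b c, E a b → E b c → ¬ E c a
  no_six : ∀ a b c d e f, E a b → E b c → E c d → E d e → E e f → ¬ E f a

lemma Clean.flip {E : V → V → Prop} (h : Clean E) : Clean (flip E) where
  no_one := h.no_one
  no_two _ _ h1 h2 := h.no_two _ _ h1 h2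
  no_three _ _ _ h1 h2 h3 := h.no_three _ _ _ h3 h2 h1
  no_six _ _ _ _ _ _ h1 h2 h3 h4 h5 h6 := h.no_six _ _ _ _ _ _ h6 h5 h4 h3 h2 h1

lemma Clean.mono {E E' : V → V → Prop} (h : Clean E) (hE : ∀ a b, E' a b → E a b) : Clean E' where
  no_one _ h1 := h.no_one _ (hE _ _ h1)
  no_two _ _ h1 h2 := h.no_two _ _ (hE _ _ h1) (hE _ _ h2)
  no_three _ _ _ h1 h2 h3 := h.no_three _ _ _ (hE _ _ h1) (hE _ _ h2) (hE _ _ h3)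
  no_six _ _ _ _ _ _ h1 h2 h3 h4 h5 h6 := h.no_six _ _ _ _ _ _ (hE _ _ h1) (hE _ _ h2)
    (hE _ _ h3) (hE _ _ h4) (hE _ _ h5) (hE _ _ h6)

/-- There are walks of all lengths from one to five between the two vertices. -/
structure Linked (E : V → V → Prop) (v q : V) : Prop where
  one : E v q
  two : ∃ a, E v a ∧ E a q
  three : ∃ a b, E v a ∧ E a b ∧ E b q
  four : ∃ a b c, E v a ∧ E a b ∧ E b c ∧ E c q
  five : ∃ a b c d, E v a ∧ E a b ∧ E b c ∧ E c d ∧ E d q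

lemma Linked.flip {E : V → V → Prop} {v q : V} (h : Linked E v q) :
    Linked (flip E) q v where
  one := h.one
  two := by obtain ⟨a, h1, h2⟩ := h.two; exact ⟨a, h2, h1⟩
  three := by obtain ⟨a, b, h1, h2, h3⟩ := h.three; exact ⟨b, a, h3, h2, h1⟩
  four := by obtain ⟨a, b, c, h1, h2, h3, h4⟩ := h.four; exact ⟨c, b, a, h4, h3, h2, h1⟩
  five := by
    obtain ⟨a, b, c, d, h1, h2, h3, h4, h5⟩ := h.five; exact ⟨d, c, b, a, h5, h4, h3, h2, h1⟩

/-- If every vertex of `A` has an out-neighbour in `A`, then `A` contains walks of length four. -/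
lemma exists_walk_of_sinkless {E : V → V → Prop} {A : Finset V} (hA : A.Nonempty)
    (h : ∀ x ∈ A, ∃ y ∈ A, E x y) :
    ∃ x₀ ∈ A, ∃ x₁ ∈ A, ∃ x₂ ∈ A, ∃ x₃ ∈ A, ∃ x₄ ∈ A,
      E x₀ x₁ ∧ E x₁ x₂ ∧ E x₂ x₃ ∧ E x₃ x₄ := by
  obtain ⟨x₀, h₀⟩ := hA
  obtain ⟨x₁, h₁, e₁⟩ := h x₀ h₀
  obtain ⟨x₂, h₂, e₂⟩ := h x₁ h₁
  obtain ⟨x₃, h₃, e₃⟩ := h x₂ h₂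
  obtain ⟨x₄, h₄, e₄⟩ := h x₃ h₃
  exact ⟨x₀, h₀, x₁, h₁, x₂, h₂, x₃, h₃, x₄, h₄, e₁, e₂, e₃, e₄⟩

variable [Fintype V]

/-- The out-neighbourhood of a vertex. -/
noncomputable def outN (E : V → V → Prop) (v : V) : Finset V := univ.filter (E v)

/-- The in-neighbourhood of a vertex. -/
noncomputable def inN (E : V → V → Prop) (v : V) : Finset V := outN (flip E) v

/-- The set `X` together with all out-neighbours of its members. -/
noncomputable def reach (E : V → V → Prop) (X : Finset V) : Finset V :=
  univ.filter fun w => w ∈ X ∨ ∃ x ∈ X, E x w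

@[simp] lemma mem_outN {E : V → V → Prop} {v w : V} : w ∈ outN E v ↔ E v w := by simp [outN]

@[simp] lemma mem_inN {E : V → V → Prop} {v w : V} : w ∈ inN E v ↔ E w v := by
  simp [inN, flip]

@[simp] lemma mem_reach {E : V → V → Prop} {X : Finset V} {w : V} :
    w ∈ reach E X ↔ w ∈ X ∨ ∃ x ∈ X, E x w := by simp [reach]

lemma sum_card_outN_eq (E : V → V → Prop) :
    ∑ v, #(outN E v) = ∑ v, #(inN E v) := by
  have := sum_card_bipartiteAbove_eq_sum_card_bipartiteBelow (s := (univ : Finset V))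
    (t := (univ : Finset V)) E
  simp only [bipartiteAbove, bipartiteBelow] at this
  simp only [outN, inN]
  convert this
  rfl

/-- A set with a vertex of small inner outdegree grows by a lot. -/
lemma card_reach_of_low {E : V → V → Prop} {X : Finset V} {δ : ℕ}
    (h : ∃ x ∈ X, 3 * #(outN E x ∩ X) ≤ #X) (hδ : ∀ x ∈ X, δ ≤ 3 * #(outN E x)) :
    2 * #X + δ ≤ 3 * #(reach E X) := by
  obtain ⟨x, hx, h⟩ := h
  have h1 : outN E x ∪ X ⊆ reach E X := by
    intro w hw
    simp only [mem_union, mem_outN, mem_reach] at hw ⊢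
    rcases hw with hw | hw
    · exact Or.inr ⟨x, hx, hw⟩
    · exact Or.inl hw
  have h2 := card_le_card h1
  have h3 := card_union_add_card_inter (outN E x) X
  have h4 := hδ x hx
  lia

lemma exists_linked_of_sinkless {E : V → V → Prop} {v : V} (hA : (outN E v).Nonempty)
    (h : ∀ x ∈ outN E v, ∃ y ∈ outN E v, E x y) : ∃ q, Linked E v q := by
  obtain ⟨x₀, h₀, x₁, h₁, x₂, h₂, x₃, h₃, x₄, h₄, e₁, e₂, e₃, e₄⟩ :=
    exists_walk_of_sinkless hA h
  rw [mem_outN] at h₀ h₁ h₂ h₃ h₄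
  exact ⟨x₄, h₄, ⟨_, h₃, e₄⟩, ⟨_, _, h₂, e₃, e₄⟩, ⟨_, _, _, h₁, e₂, e₃, e₄⟩,
    ⟨_, _, _, _, h₀, e₁, e₂, e₃, e₄⟩⟩

/-- Vertices close to the end of a linked pair have no edge to its start. -/
lemma Clean.not_edge_of_linked {E : V → V → Prop} (hE : Clean E) {v t : V} {Q : Finset V}
    (hQ : ∀ q ∈ Q, Linked E v q) (ht : t ∈ reach E (reach E (reach E Q))) : ¬ E t v := by
  simp only [mem_reach] at ht
  intro htv
  rcases ht with ((hq | ⟨q, hq, h1⟩) | ⟨a, hq | ⟨q, hq, h1⟩, h2⟩) |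
    ⟨b, (hq | ⟨q, hq, h1⟩) | ⟨a, hq | ⟨q, hq, h1⟩, h2⟩, h3⟩
  · exact hE.no_two _ _ (hQ _ hq).one htv
  · obtain ⟨_, _, _, k1, k2, k3, k4⟩ := (hQ _ hq).four
    exact hE.no_six _ _ _ _ _ _ k1 k2 k3 k4 h1 htv
  · obtain ⟨_, _, _, k1, k2, k3, k4⟩ := (hQ _ hq).four
    exact hE.no_six _ _ _ _ _ _ k1 k2 k3 k4 h2 htv
  · obtain ⟨_, _, k1, k2, k3⟩ := (hQ _ hq).three
    exact hE.no_six _ _ _ _ _ _ k1 k2 k3 h1 h2 htv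
  · obtain ⟨_, _, _, k1, k2, k3, k4⟩ := (hQ _ hq).four
    exact hE.no_six _ _ _ _ _ _ k1 k2 k3 k4 h3 htv
  · obtain ⟨_, _, k1, k2, k3⟩ := (hQ _ hq).three
    exact hE.no_six _ _ _ _ _ _ k1 k2 k3 h1 h3 htv
  · obtain ⟨_, _, k1, k2, k3⟩ := (hQ _ hq).three
    exact hE.no_six _ _ _ _ _ _ k1 k2 k3 h2 h3 htv
  · obtain ⟨_, k1, k2⟩ := (hQ _ hq).two
    exact hE.no_six _ _ _ _ _ _ k1 k2 h1 h2 h3 htv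

lemma subset_reach (E : V → V → Prop) (X : Finset V) : X ⊆ reach E X := by
  intro x hx; simp [hx]

lemma reach_subset {E : V → V → Prop} {X S : Finset V} (hX : X ⊆ S)
    (hS : ∀ a b, E a b → b ∈ S) : reach E X ⊆ S := by
  intro x hx
  rw [mem_reach] at hx
  rcases hx with hx | ⟨y, -, hy⟩
  · exact hX hx
  · exact hS _ _ hy

lemma exists_low_of_confined (S : Finset V) (hS : S.Nonempty) {E : V → V → Prop}
    (hE : Clean E) (hES : ∀ a b, E a b → a ∈ S ∧ b ∈ S)
    (IH : ∀ X ⊂ S, X.Nonempty → ∃ x ∈ X, 3 * #(outN E x ∩ X) ≤ #X) :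
    ∃ x ∈ S, 3 * #(outN E x) ≤ #S := by
  by_contra! hcon
  have hout : ∀ v, outN E v ⊆ S := fun v w hw => (hES v w (mem_outN.1 hw)).2
  have hin : ∀ v, inN E v ⊆ S := fun v w hw => (hES w v (mem_inN.1 hw)).1
  have key : ∀ v ∈ S, 3 * #(inN E v) ≤ #S := by
    intro v hv
    have hAne : (outN E v).Nonempty := by
      rw [← card_pos]; have := hcon v hv; lia
    by_cases hs : ∃ x ∈ outN E v, ∀ y ∈ outN E v, ¬ E x y
    · obtain ⟨x, hx, hxs⟩ := hs
      have d1 : Disjoint (outN E v) (outN E x) := by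
        rw [disjoint_left]; intro y h1 h2; exact hxs y h1 (mem_outN.1 h2)
      have d2 : Disjoint (outN E v ∪ outN E x) (inN E v) := by
        rw [disjoint_left]; intro y h1 h2
        simp only [mem_union, mem_outN, mem_inN] at h1 h2 hx
        rcases h1 with h1 | h1
        · exact hE.no_two _ _ h1 h2
        · exact hE.no_three _ _ _ hx h1 h2
      have c := card_le_card (union_subset (union_subset (hout v) (hout x)) (hin v))
      rw [card_union_of_disjoint d2, card_union_of_disjoint d1] at c
      have := hcon v hv
      have := hcon x (hout v hx)
      lia
    · push Not at hs
      obtain ⟨q, hq⟩ := exists_linked_of_sinkless hAne hs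
      rcases (inN E v).eq_empty_or_nonempty with h0 | ⟨y, hy⟩
      · simp [h0]
      have hQ : ∀ p ∈ ({q} : Finset V), Linked E v p := by simpa using hq
      have s0 : ({q} : Finset V) ⊆ S := by simpa using (hES _ _ hq.one).2
      have hS2 : ∀ a b, E a b → b ∈ S := fun a b h => (hES a b h).2
      have s1 := reach_subset s0 hS2
      have s2 := reach_subset s1 hS2
      have s3 := reach_subset s2 hS2
      have hd : ∀ t ∈ reach E (reach E (reach E {q})), ¬ E t v :=
        fun t ht => hE.not_edge_of_linked hQ ht
      have grow : ∀ X ⊆ reach E (reach E (reach E {q})), X.Nonempty →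
          2 * #X + (#S + 1) ≤ 3 * #(reach E X) := by
        intro X hX hX0
        refine card_reach_of_low (IH X ?_ hX0) (fun x hx => hcon x (s3 (hX hx)))
        refine (ssubset_iff_of_subset (hX.trans s3)).2 ⟨y, hin v hy, fun h => ?_⟩
        exact hd y (hX h) (mem_inN.1 hy)
      have i0 := subset_reach E {q}
      have i1 := subset_reach E (reach E {q})
      have i2 := subset_reach E (reach E (reach E {q}))
      have g0 := grow _ (i0.trans (i1.trans i2)) (by simp)
      have g1 := grow _ (i1.trans i2) ⟨q, i0 (by simp)⟩
      have g2 := grow _ i2 ⟨q, i1 (i0 (by simp))⟩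
      have dd : Disjoint (reach E (reach E (reach E {q}))) (inN E v) := by
        rw [disjoint_left]; intro t h1 h2; exact hd t h1 (mem_inN.1 h2)
      have c := card_le_card (union_subset s3 (hin v))
      rw [card_union_of_disjoint dd] at c
      rw [card_singleton] at g0
      lia
  have hsum := sum_card_outN_eq E
  have z1 : ∑ v, #(outN E v) = ∑ v ∈ S, #(outN E v) := by
    refine (sum_subset (subset_univ S) fun x _ hx => ?_).symm
    rw [card_eq_zero, eq_empty_iff_forall_notMem]
    intro y hy; exact hx (hES _ _ (mem_outN.1 hy)).1
  have z2 : ∑ v, #(inN E v) = ∑ v ∈ S, #(inN E v) := by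
    refine (sum_subset (subset_univ S) fun x _ hx => ?_).symm
    rw [card_eq_zero, eq_empty_iff_forall_notMem]
    intro y hy; exact hx (hES _ _ (mem_inN.1 hy)).2
  have : ∑ v ∈ S, #(inN E v) < ∑ v ∈ S, #(outN E v) := by
    refine sum_lt_sum_of_nonempty hS fun v hv => ?_
    have := key v hv
    have := hcon v hv
    lia
  lia

/-- The special case of the Caccetta--Häggkvist phenomenon for relations without closed walks of
length at most three and of length six. -/
theorem Clean.exists_low {E : V → V → Prop} (hE : Clean E) (X : Finset V) (hX : X.Nonempty) :
    ∃ x ∈ X, 3 * #(outN E x ∩ X) ≤ #X := by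
  induction X using Finset.strongInduction with
  | H S IH =>
    let E' : V → V → Prop := fun a b => E a b ∧ a ∈ S ∧ b ∈ S
    have hN : ∀ x ∈ S, outN E' x = outN E x ∩ S := by
      intro x hx; ext w; simp [E', hx]
    obtain ⟨x, hx, h⟩ := exists_low_of_confined S hX (E := E') (hE.mono fun a b h => h.1)
      (fun a b h => h.2) (by
        intro X hXS hX0
        obtain ⟨x, hx, h⟩ := IH X hXS hX0
        refine ⟨x, hx, ?_⟩
        rwa [hN x (hXS.1 hx), inter_assoc, inter_eq_right.2 hXS.1])
    exact ⟨x, hx, by rwa [hN x hx] at h⟩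

lemma Clean.card_reach {E : V → V → Prop} (hE : Clean E) {X : Finset V} (hX : X.Nonempty) {δ : ℕ}
    (hδ : ∀ x ∈ X, δ ≤ #(outN E x)) : 2 * #X + 3 * δ ≤ 3 * #(reach E X) :=
  card_reach_of_low (hE.exists_low X hX) fun x hx => Nat.mul_le_mul_left 3 (hδ x hx)

end

section

variable {V : Type*}

/-- An edge `u → w` lying in at least two directed triangles. -/
def Heavy (R : V → V → Prop) (u w : V) : Prop :=
  R u w ∧ ∀ x, ∃ t, t ≠ x ∧ R w t ∧ R t u

/-- An edge `u → w` lying in a directed triangle none of whose edges is heavy. -/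
def Light (R : V → V → Prop) (u w : V) : Prop :=
  ∃ t, R u w ∧ R w t ∧ R t u ∧ ¬ Heavy R u w ∧ ¬ Heavy R w t ∧ ¬ Heavy R t u

/-- The bipartite double cover of the relation has no four-cycle. -/
def FourCycleFree (D : V → V → Prop) : Prop :=
  ∀ u u' w w', D u w → D u w' → D u' w → D u' w' → u = u' ∨ w = w'

lemma heavy_flip {R : V → V → Prop} {u w : V} : Heavy (flip R) w u ↔ Heavy R u w := by
  simp only [Heavy, flip, and_comm]

lemma FourCycleFree.flip {D : V → V → Prop} (h : FourCycleFree D) : FourCycleFree (flip D) :=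
  fun u u' w w' h1 h2 h3 h4 => (h w w' u u' h1 h3 h2 h4).symm

variable [Fintype V]

/-- Large oriented graphs with large minimum semidegree and without directed six-cycles. -/
structure SixFree (R : V → V → Prop) : Prop where
  asymm : ∀ a b, R a b → ¬ R b a
  out_deg : ∀ v, Fintype.card V + 2 ≤ 4 * #(outN R v)
  in_deg : ∀ v, Fintype.card V + 2 ≤ 4 * #(inN R v)
  no_six : ∀ a b c d e f, R a b → R b c → R c d → R d e → R e f → R f a →
    a ≠ d → b ≠ e → c ≠ f → False
  large : 1000000000 ≤ Fintype.card V

lemma SixFree.flip {R : V → V → Prop} (h : SixFree R) : SixFree (flip R) where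
  asymm _ _ h1 h2 := h.asymm _ _ h1 h2
  out_deg := h.in_deg
  in_deg := h.out_deg
  no_six a b c d e f h1 h2 h3 h4 h5 h6 n1 n2 n3 :=
    h.no_six f e d c b a h5 h4 h3 h2 h1 h6 n3.symm n2.symm n1.symm
  large := h.large

lemma SixFree.irrefl {R : V → V → Prop} (h : SixFree R) (a : V) : ¬ R a a :=
  fun h1 => h.asymm a a h1 h1

lemma SixFree.ne {R : V → V → Prop} (h : SixFree R) {a b : V} (hab : R a b) : a ≠ b := by
  rintro rfl; exact h.irrefl _ hab

lemma SixFree.fourCycleFree_heavy {R : V → V → Prop} (h : SixFree R) :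
    FourCycleFree (Heavy R) := by
  intro u u' w w' h1 h2 h3 h4
  by_contra! hn
  obtain ⟨t, -, k1, k2⟩ := h2.2 u
  obtain ⟨t', kn, k3, k4⟩ := h3.2 t
  exact h.no_six u w t' u' w' t h1.1 k3 k4 h4.1 k1 k2 hn.1 hn.2 kn

lemma SixFree.fourCycleFree_light {R : V → V → Prop} (h : SixFree R) :
    FourCycleFree (Light R) := by
  intro u u' w w' h1 h2 h3 h4
  by_contra! hn
  obtain ⟨t, r1, k1, k2, -, -, n1⟩ := h2
  obtain ⟨t', r2, k3, k4, -⟩ := h3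
  obtain ⟨_, r3, -⟩ := h1
  obtain ⟨_, r4, -⟩ := h4
  by_cases ht : t' = t
  · subst ht
    refine n1 ⟨k2, fun x => ?_⟩
    by_cases hx : w = x
    · exact ⟨w', fun h => hn.2 (hx.trans h.symm), r1, k1⟩
    · exact ⟨w, hx, r3, k3⟩
  · exact h.no_six u w t' u' w' t r3 k3 k4 r4 k1 k2 hn.1 hn.2 ht

lemma FourCycleFree.card_le {D : V → V → Prop} (hD : FourCycleFree D) {k : ℕ} (B : Finset V)
    (hB : ∀ u ∈ B, k ≤ #(outN D u)) : #B * k ≤ #(B.biUnion (outN D)) + #B * #B := by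
  induction B using Finset.induction_on with
  | empty => simp
  | insert a B ha IH =>
    have IH := IH fun u hu => hB u (mem_insert_of_mem hu)
    have h1 := hB a (mem_insert_self a B)
    have h2 : #(outN D a ∩ B.biUnion (outN D)) ≤ #B * 1 := by
      rw [inter_biUnion]
      refine card_biUnion_le_card_mul _ _ _ fun u hu => ?_
      rw [card_le_one]
      intro w hw w' hw'
      simp only [mem_inter, mem_outN] at hw hw'
      refine (hD a u w w' hw.1 hw'.1 hw.2 hw'.2).resolve_left ?_
      rintro rfl; exact ha hu
    have h3 := card_union_add_card_inter (outN D a) (B.biUnion (outN D))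
    rw [biUnion_insert, card_insert_of_notMem ha]
    nlinarith

/-- Vertices of linear outdegree. -/
noncomputable def highOut (D : V → V → Prop) : Finset V :=
  univ.filter fun v => Fintype.card V ≤ 4000 * #(outN D v)

lemma FourCycleFree.card_highOut_lt {D : V → V → Prop} (hD : FourCycleFree D)
    (hn : 1000000000 ≤ Fintype.card V) : #(highOut D) < 5000 := by
  by_contra! h
  obtain ⟨B, hB, hc⟩ := exists_subset_card_eq h
  have h1 := hD.card_le (k := Fintype.card V / 4000) B (fun u hu => by
    have := hB hu
    simp only [highOut, mem_filter, mem_univ, true_and] at this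
    lia)
  have h2 := card_le_univ (B.biUnion (outN D))
  rw [hc] at h1
  lia

/-- A clean subgraph `E` of `R` living on a set `W` avoiding `F`, with large semidegrees. -/
structure Env (R : V → V → Prop) (F W : Finset V) (E : V → V → Prop) (δ : ℕ) : Prop where
  clean : Clean E
  sub : ∀ a b, E a b → R a b
  left : ∀ a b, E a b → a ∈ W
  right : ∀ a b, E a b → b ∈ W
  avoid : ∀ a ∈ F, a ∉ W
  not_heavy : ∀ a b, E a b → ¬ Heavy R a b
  large : 249 * Fintype.card V ≤ 1000 * δ
  pos : 0 < Fintype.card V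
  out_deg : ∀ a ∈ W, δ ≤ #(outN E a)
  in_deg : ∀ a ∈ W, δ ≤ #(inN E a)
  out_deg_inter : ∀ a, δ ≤ #(outN R a ∩ W)
  in_deg_inter : ∀ a, δ ≤ #(inN R a ∩ W)

lemma Env.flip {R E : V → V → Prop} {F W : Finset V} {δ : ℕ} (h : Env R F W E δ) :
    Env (flip R) F W (flip E) δ where
  clean := h.clean.flip
  sub _ _ h1 := h.sub _ _ h1
  left _ _ h1 := h.right _ _ h1
  right _ _ h1 := h.left _ _ h1
  avoid := h.avoid
  not_heavy _ _ h1 h2 := h.not_heavy _ _ h1 (heavy_flip.1 h2)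
  large := h.large
  pos := h.pos
  out_deg := h.in_deg
  in_deg := h.out_deg
  out_deg_inter := h.in_deg_inter
  in_deg_inter := h.out_deg_inter

lemma SixFree.exists_env {R : V → V → Prop} (h : SixFree R) (F : Finset V) (hF : #F ≤ 10) :
    ∃ W E δ, Env R F W E δ := by
  set X : Finset V := (((F ∪ highOut (Heavy R)) ∪ highOut (_root_.flip (Heavy R))) ∪
    highOut (Light R)) ∪ highOut (_root_.flip (Light R)) with hX
  have cX : #X ≤ 20010 := by
    have c1 := h.fourCycleFree_heavy.card_highOut_lt h.large
    have c2 := h.fourCycleFree_heavy.flip.card_highOut_lt h.large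
    have c3 := h.fourCycleFree_light.card_highOut_lt h.large
    have c4 := h.fourCycleFree_light.flip.card_highOut_lt h.large
    rw [hX]
    have d1 := card_union_le F (highOut (Heavy R))
    have d2 := card_union_le (F ∪ highOut (Heavy R)) (highOut (_root_.flip (Heavy R)))
    have d3 := card_union_le ((F ∪ highOut (Heavy R)) ∪ highOut (_root_.flip (Heavy R)))
      (highOut (Light R))
    have d4 := card_union_le (((F ∪ highOut (Heavy R)) ∪ highOut (_root_.flip (Heavy R))) ∪
      highOut (Light R)) (highOut (_root_.flip (Light R)))
    lia
  have hlow : ∀ v ∉ X, 4000 * #(outN (Heavy R) v) < Fintype.card V ∧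
      4000 * #(inN (Heavy R) v) < Fintype.card V ∧
      4000 * #(outN (Light R) v) < Fintype.card V ∧
      4000 * #(inN (Light R) v) < Fintype.card V := by
    intro v hv
    simp only [hX, highOut, mem_union, mem_filter, mem_univ, true_and, not_or, not_le] at hv
    exact ⟨hv.1.1.1.2, hv.1.1.2, hv.1.2, hv.2⟩
  have hn := h.large
  let E : V → V → Prop := fun a b => a ∉ X ∧ b ∉ X ∧ R a b ∧ ¬ Heavy R a b ∧ ¬ Light R a b
  have out : ∀ v, 2 * Fintype.card V ≤ 8 * #(outN R v ∩ Xᶜ) + 200000 := by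
    intro v
    have c1 : outN R v ⊆ (outN R v ∩ Xᶜ) ∪ X := by
      intro w hw
      by_cases hwX : w ∈ X <;> simp_all
    have c2 := (card_le_card c1).trans (card_union_le _ _)
    have := h.out_deg v
    lia
  have inn : ∀ v, 2 * Fintype.card V ≤ 8 * #(inN R v ∩ Xᶜ) + 200000 := by
    intro v
    have c1 : inN R v ⊆ (inN R v ∩ Xᶜ) ∪ X := by
      intro w hw
      by_cases hwX : w ∈ X <;> simp_all
    have c2 := (card_le_card c1).trans (card_union_le _ _)
    have := h.in_deg v
    lia
  refine ⟨Xᶜ, E, (249 * Fintype.card V + 999) / 1000, ?_⟩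
  have no_three : ∀ a b c, E a b → E b c → ¬ E c a := by
    rintro a b c ⟨-, -, r1, k1, l1⟩ ⟨-, -, r2, k2, -⟩ ⟨-, -, r3, k3, -⟩
    exact l1 ⟨c, r1, r2, r3, k1, k2, k3⟩
  constructor
  · constructor
    · exact fun a h1 => h.irrefl a h1.2.2.1
    · exact fun a b h1 h2 => h.asymm a b h1.2.2.1 h2.2.2.1
    · exact no_three
    · intro a b c d e f h1 h2 h3 h4 h5 h6
      refine h.no_six a b c d e f h1.2.2.1 h2.2.2.1 h3.2.2.1 h4.2.2.1 h5.2.2.1 h6.2.2.1 ?_ ?_ ?_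
      · rintro rfl; exact no_three _ _ _ h1 h2 h3
      · rintro rfl; exact no_three _ _ _ h2 h3 h4
      · rintro rfl; exact no_three _ _ _ h3 h4 h5
  · exact fun a b h1 => h1.2.2.1
  · exact fun a b h1 => mem_compl.2 h1.1
  · exact fun a b h1 => mem_compl.2 h1.2.1
  · intro a ha; simp [hX, ha]
  · exact fun a b h1 => h1.2.2.2.1
  · lia
  · lia
  · intro a ha
    have haX : a ∉ X := mem_compl.1 ha
    have c1 : outN R a ∩ Xᶜ ⊆ (outN E a ∪ outN (Heavy R) a) ∪ outN (Light R) a := by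
      intro w hw
      simp only [mem_inter, mem_compl, mem_union, mem_outN, E] at hw ⊢
      tauto
    have c2 := card_le_card c1
    have c3 := card_union_le (outN E a ∪ outN (Heavy R) a) (outN (Light R) a)
    have c4 := card_union_le (outN E a) (outN (Heavy R) a)
    have := out a
    obtain ⟨g1, g2, g3, g4⟩ := hlow a haX
    lia
  · intro a ha
    have haX : a ∉ X := mem_compl.1 ha
    have c1 : inN R a ∩ Xᶜ ⊆ (inN E a ∪ inN (Heavy R) a) ∪ inN (Light R) a := by
      intro w hw
      simp only [mem_inter, mem_compl, mem_union, mem_inN, E] at hw ⊢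
      tauto
    have c2 := card_le_card c1
    have c3 := card_union_le (inN E a ∪ inN (Heavy R) a) (inN (Light R) a)
    have c4 := card_union_le (inN E a) (inN (Heavy R) a)
    have := inn a
    obtain ⟨g1, g2, g3, g4⟩ := hlow a haX
    lia
  · intro a
    have := out a
    lia
  · intro a
    have := inn a
    lia

end

section

variable {V : Type*}

lemma Linked.trans_edge {E : V → V → Prop} {v q y : V} (h : Linked E v q) (hqy : E q y)
    (hvy : E v y) : Linked E v y where
  one := hvy
  two := ⟨q, h.one, hqy⟩
  three := by obtain ⟨a, h1, h2⟩ := h.two; exact ⟨a, q, h1, h2, hqy⟩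
  four := by obtain ⟨a, b, h1, h2, h3⟩ := h.three; exact ⟨a, b, q, h1, h2, h3, hqy⟩
  five := by
    obtain ⟨a, b, c, h1, h2, h3, h4⟩ := h.four; exact ⟨a, b, c, q, h1, h2, h3, h4, hqy⟩

variable [Fintype V]

lemma Clean.not_path_of_linked {E : V → V → Prop} (hE : Clean E) {v t z : V} {Q : Finset V}
    (hQ : ∀ q ∈ Q, Linked E v q) (ht : t ∈ reach E (reach E (reach E Q))) (htz : E t z) :
    ¬ E z v := by
  simp only [mem_reach] at ht
  intro hzv
  rcases ht with ((hq | ⟨q, hq, h1⟩) | ⟨a, hq | ⟨q, hq, h1⟩, h2⟩) |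
    ⟨b, (hq | ⟨q, hq, h1⟩) | ⟨a, hq | ⟨q, hq, h1⟩, h2⟩, h3⟩
  · exact hE.no_three _ _ _ (hQ _ hq).one htz hzv
  · obtain ⟨_, _, k1, k2, k3⟩ := (hQ _ hq).three
    exact hE.no_six _ _ _ _ _ _ k1 k2 k3 h1 htz hzv
  · obtain ⟨_, _, k1, k2, k3⟩ := (hQ _ hq).three
    exact hE.no_six _ _ _ _ _ _ k1 k2 k3 h2 htz hzv
  · obtain ⟨_, k1, k2⟩ := (hQ _ hq).two
    exact hE.no_six _ _ _ _ _ _ k1 k2 h1 h2 htz hzv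
  · obtain ⟨_, _, k1, k2, k3⟩ := (hQ _ hq).three
    exact hE.no_six _ _ _ _ _ _ k1 k2 k3 h3 htz hzv
  · obtain ⟨_, k1, k2⟩ := (hQ _ hq).two
    exact hE.no_six _ _ _ _ _ _ k1 k2 h1 h3 htz hzv
  · obtain ⟨_, k1, k2⟩ := (hQ _ hq).two
    exact hE.no_six _ _ _ _ _ _ k1 k2 h2 h3 htz hzv
  · exact hE.no_six _ _ _ _ _ _ (hQ _ hq).one h1 h2 h3 htz hzv

variable {R E : V → V → Prop} {F W : Finset V} {δ : ℕ}

lemma Env.card_reach (h : Env R F W E δ) {X : Finset V} (hX : X ⊆ W) (h0 : X.Nonempty) :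
    2 * #X + 3 * δ ≤ 3 * #(reach E X) :=
  h.clean.card_reach h0 fun x hx => h.out_deg x (hX hx)

lemma Env.delta_pos (h : Env R F W E δ) : 0 < δ := by
  have := h.pos
  have := h.large
  lia

lemma Env.nonempty (h : Env R F W E δ) {X : Finset V} (hX : δ ≤ #X) : X.Nonempty := by
  rw [← card_pos]; exact h.delta_pos.trans_le hX

lemma Env.reach_subset (h : Env R F W E δ) {X : Finset V} (hX : X ⊆ W) : reach E X ⊆ W :=
  SemidegreeC6.reach_subset hX h.right

lemma Env.outN_subset (h : Env R F W E δ) (v : V) : outN E v ⊆ W :=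
  fun _ hw => h.right _ _ (mem_outN.1 hw)

lemma Env.inN_subset (h : Env R F W E δ) (v : V) : inN E v ⊆ W := h.flip.outN_subset v

lemma Env.card_reach_of_sink (h : Env R F W E δ) {X : Finset V} (hX : X ⊆ W) (hc : δ ≤ #X)
    (hs : ∃ x ∈ X, ∀ y ∈ X, ¬ E x y) : 2 * δ ≤ #(reach E X) := by
  obtain ⟨x, hx, hs⟩ := hs
  have d : Disjoint X (outN E x) := by
    rw [disjoint_left]; intro y h1 h2; exact hs y h1 (mem_outN.1 h2)
  have c : X ∪ outN E x ⊆ reach E X := by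
    intro y hy
    rw [mem_union, mem_outN] at hy
    rw [mem_reach]
    exact hy.imp id fun hy => ⟨x, hx, hy⟩
  have c := card_le_card c
  rw [card_union_of_disjoint d] at c
  have := h.out_deg x (hX hx)
  lia

lemma card_add_card_le_of_disjoint {X Y : Finset V} (h : Disjoint X Y) :
    #X + #Y ≤ Fintype.card V := by
  rw [← card_union_of_disjoint h]; exact card_le_univ _

lemma exists_balanced (L : V → V → Prop) {a b : V} (hab : L a b) :
    ∃ v, (outN L v).Nonempty ∧ #(inN L v) ≤ #(outN L v) := by
  by_contra! hcon
  refine (sum_card_outN_eq L).not_lt (sum_lt_sum (fun v _ => ?_) ⟨a, mem_univ _, ?_⟩)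
  · rcases (outN L v).eq_empty_or_nonempty with h0 | h0
    · simp [h0]
    · exact (hcon v h0).le
  · exact hcon a ⟨b, mem_outN.2 hab⟩

lemma Env.not_linked (h : Env R F W E δ) (a b : V) : ¬ Linked E a b := by
  intro hab
  obtain ⟨v, hv0, hv⟩ := exists_balanced (Linked E) hab
  have hvW : v ∈ W := by
    obtain ⟨q, hq⟩ := hv0; exact h.left _ _ (mem_outN.1 hq).one
  set A := outN (Linked E) v with hA
  have hQ : ∀ q ∈ A, Linked E v q := fun q hq => mem_outN.1 hq
  have s0 : A ⊆ W := fun q hq => h.right _ _ (hQ q hq).one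
  have s1 := h.reach_subset s0
  have s2 := h.reach_subset s1
  have g0 := h.card_reach s0 hv0
  have g1 := h.card_reach s1 (hv0.mono (subset_reach _ _))
  have g2 := h.card_reach s2 ((hv0.mono (subset_reach _ _)).mono (subset_reach _ _))
  have cZ := h.in_deg v hvW
  have sZ := h.inN_subset v
  have m1 := h.flip.card_reach sZ (h.nonempty cZ)
  have m2 : 6 * δ ≤ 3 * #(reach (_root_.flip E) (inN E v)) + #(inN (Linked E) v) := by
    rcases (inN (Linked E) v).eq_empty_or_nonempty with h0 | h0
    · have := h.flip.card_reach_of_sink sZ cZ (by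
        by_contra! hs
        obtain ⟨q, hq⟩ := exists_linked_of_sinkless (h.nonempty cZ) hs
        exact notMem_empty q (h0 ▸ mem_inN.2 hq.flip))
      lia
    · obtain ⟨z, hz, hz'⟩ := h.clean.flip.exists_low _ h0
      have hz1 : Linked E z v := mem_inN.1 hz
      have c1 : outN (_root_.flip E) z ∩ inN E v ⊆ outN (_root_.flip E) z ∩ inN (Linked E) v := by
        intro y hy
        simp only [mem_inter, mem_outN, mem_inN] at hy ⊢
        exact ⟨hy.1, (hz1.flip.trans_edge hy.1 hy.2).flip⟩
      have c2 : outN (_root_.flip E) z ∪ inN E v ⊆ reach (_root_.flip E) (inN E v) := by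
        intro y hy
        simp only [mem_union, mem_reach, mem_outN, mem_inN] at hy ⊢
        exact hy.symm.imp id fun hy => ⟨z, hz1.one, hy⟩
      have c1 := card_le_card c1
      have c2 := card_le_card c2
      have c3 := card_union_add_card_inter (outN (_root_.flip E) z) (inN E v)
      have c4 := h.in_deg z (h.left _ _ hz1.one)
      unfold inN at *
      lia
  have d : Disjoint (reach E (reach E (reach E A))) (reach (_root_.flip E) (inN E v)) := by
    rw [disjoint_left]
    intro t h1 h2
    simp only [mem_reach (E := _root_.flip E), mem_inN] at h2
    rcases h2 with h2 | ⟨z, hz, h2⟩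
    · exact h.clean.not_edge_of_linked hQ h1 h2
    · exact h.clean.not_path_of_linked hQ h1 h2 hz
  have c := card_add_card_le_of_disjoint d
  have i0 := card_le_card (subset_reach E A)
  have i1 := card_le_card (subset_reach E (reach E A))
  have i2 := card_le_card (subset_reach E (reach E (reach E A)))
  have := h.large
  have := h.pos
  lia

lemma Env.exists_sink (h : Env R F W E δ) {w : V} (hw : w ∈ W) :
    ∃ x ∈ outN E w, ∀ y ∈ outN E w, ¬ E x y := by
  by_contra! hs
  obtain ⟨q, hq⟩ := exists_linked_of_sinkless (h.nonempty (h.out_deg w hw)) hs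
  exact h.not_linked _ _ hq

lemma Env.card_reach_outN (h : Env R F W E δ) {w : V} (hw : w ∈ W) :
    2 * δ ≤ #(reach E (outN E w)) :=
  h.card_reach_of_sink (h.outN_subset w) (h.out_deg w hw) (h.exists_sink hw)

/-- There is no closed walk of length six having exactly one vertex outside `W`. -/
lemma Env.not_closed (h : Env R F W E δ) (hR : SixFree R) {v a b c d e : V} (hv : v ∉ W)
    (hva : R v a) (hab : E a b) (hbc : E b c) (hcd : E c d) (hde : E d e) : ¬ R e v := by
  intro hev
  refine hR.no_six v a b c d e hva (h.sub _ _ hab) (h.sub _ _ hbc) (h.sub _ _ hcd)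
    (h.sub _ _ hde) hev ?_ ?_ ?_
  · rintro rfl; exact hv (h.left _ _ hcd)
  · rintro rfl; exact h.clean.no_three _ _ _ hab hbc hcd
  · rintro rfl; exact h.clean.no_three _ _ _ hbc hcd hde

lemma Env.exists_sink_inter (h : Env R F W E δ) (hR : SixFree R) {v : V} (hv : v ∉ W) :
    ∃ x ∈ outN R v ∩ W, ∀ y ∈ outN R v ∩ W, ¬ E x y := by
  by_contra! hs
  obtain ⟨x₀, h₀, x₁, h₁, x₂, h₂, x₃, h₃, x₄, h₄, e₁, e₂, e₃, e₄⟩ :=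
    exists_walk_of_sinkless (h.nonempty (h.out_deg_inter v)) hs
  simp only [mem_inter, mem_outN] at h₀ h₁ h₂ h₃ h₄
  have g := h.card_reach_outN h₄.2
  have cZ := h.in_deg_inter v
  have sZ : inN R v ∩ W ⊆ W := inter_subset_right
  have m1 := h.flip.card_reach sZ (h.nonempty cZ)
  have m2 := h.flip.card_reach (h.flip.reach_subset sZ)
    ((h.nonempty cZ).mono (subset_reach _ _))
  have d : Disjoint (reach E (outN E x₄)) (reach (_root_.flip E) (reach (_root_.flip E) (inN R v ∩ W))) := by
    rw [disjoint_left]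
    intro t k1 k2
    simp only [mem_reach, mem_outN, mem_inN, mem_inter] at k1 k2
    rcases k1 with k1 | ⟨s, k1, k1'⟩ <;>
    rcases k2 with (⟨k2, -⟩ | ⟨z, ⟨k2, -⟩, k3⟩) | ⟨y, (⟨k2, -⟩ | ⟨z, ⟨k2, -⟩, k3⟩), k4⟩
    · exact h.not_closed hR hv h₁.1 e₂ e₃ e₄ k1 k2
    · exact h.not_closed hR hv h₂.1 e₃ e₄ k1 k3 k2
    · exact h.not_closed hR hv h₂.1 e₃ e₄ k1 k4 k2
    · exact h.not_closed hR hv h₃.1 e₄ k1 k4 k3 k2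
    · exact h.not_closed hR hv h₂.1 e₃ e₄ k1 k1' k2
    · exact h.not_closed hR hv h₃.1 e₄ k1 k1' k3 k2
    · exact h.not_closed hR hv h₃.1 e₄ k1 k1' k4 k2
    · exact h.not_closed hR hv h₄.1 k1 k1' k4 k3 k2
  have c := card_add_card_le_of_disjoint d
  have := h.large
  have := h.pos
  lia

lemma Env.card_reach_inter (h : Env R F W E δ) (hR : SixFree R) {v : V} (hv : v ∉ W) :
    2 * δ ≤ #(reach E (outN R v ∩ W)) :=
  h.card_reach_of_sink inter_subset_right (h.out_deg_inter v) (h.exists_sink_inter hR hv)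

end

section

variable {V : Type*} [Fintype V] {R : V → V → Prop}

/-- An out-neighbourhood contains no path on four vertices. -/
lemma SixFree.eq_of_path (hR : SixFree R) {v x₁ x₂ x₃ x₄ : V} (h₁ : R v x₁) (h₂ : R v x₂)
    (h₃ : R v x₃) (h₄ : R v x₄) (e₁ : R x₁ x₂) (e₂ : R x₂ x₃) (e₃ : R x₃ x₄) : x₁ = x₄ := by
  by_contra hne
  obtain ⟨W, E, δ, h⟩ := hR.exists_env {v, x₁, x₂, x₃, x₄} (card_le_five.trans (by norm_num))
  have hW : ∀ y ∈ W, v ≠ y ∧ x₁ ≠ y ∧ x₂ ≠ y ∧ x₃ ≠ y ∧ x₄ ≠ y := by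
    intro y hy
    refine ⟨?_, ?_, ?_, ?_, ?_⟩ <;> rintro rfl <;> exact h.avoid _ (by simp) hy
  have g := h.card_reach_inter hR (h.avoid x₄ (by simp))
  have cZ := h.in_deg_inter v
  have sZ : inN R v ∩ W ⊆ W := inter_subset_right
  have m1 := h.flip.card_reach sZ (h.nonempty cZ)
  have m2 := h.flip.card_reach (h.flip.reach_subset sZ)
    ((h.nonempty cZ).mono (subset_reach _ _))
  have len0 : ∀ s, R x₄ s → s ∈ W → R s v → False := fun s k1 k2 k3 =>
    hR.no_six v x₁ x₂ x₃ x₄ s h₁ e₁ e₂ e₃ k1 k3 (hR.ne h₃) hne (hW s k2).2.2.1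
  have len1 : ∀ s a, R x₄ s → E s a → R a v → False := fun s a k1 k2 k3 =>
    hR.no_six v x₂ x₃ x₄ s a h₂ e₂ e₃ k1 (h.sub _ _ k2) k3 (hR.ne h₄)
      (hW s (h.left _ _ k2)).2.2.1 (hW a (h.right _ _ k2)).2.2.2.1
  have len2 : ∀ s a b, R x₄ s → E s a → E a b → R b v → False := fun s a b k1 k2 k3 k4 =>
    hR.no_six v x₃ x₄ s a b h₃ e₃ k1 (h.sub _ _ k2) (h.sub _ _ k3) k4
      (hW s (h.left _ _ k2)).1 (hW a (h.right _ _ k2)).2.2.2.1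
      (hW b (h.right _ _ k3)).2.2.2.2
  have len3 : ∀ s a b d, R x₄ s → E s a → E a b → E b d → R d v → False := by
    intro s a b d k1 k2 k3 k4 k5
    refine hR.no_six v x₄ s a b d h₄ k1 (h.sub _ _ k2) (h.sub _ _ k3) (h.sub _ _ k4) k5
      (hW a (h.right _ _ k2)).1 (hW b (h.right _ _ k3)).2.2.2.2 ?_
    rintro rfl; exact h.clean.no_three _ _ _ k2 k3 k4
  have d : Disjoint (reach E (outN R x₄ ∩ W))
      (reach (_root_.flip E) (reach (_root_.flip E) (inN R v ∩ W))) := by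
    rw [disjoint_left]
    intro t k1 k2
    simp only [mem_reach, mem_outN, mem_inN, mem_inter] at k1 k2
    rcases k1 with ⟨k1, k0⟩ | ⟨s, ⟨k1, k0⟩, k1'⟩ <;>
    rcases k2 with (⟨k2, -⟩ | ⟨z, ⟨k2, -⟩, k3⟩) | ⟨y, (⟨k2, -⟩ | ⟨z, ⟨k2, -⟩, k3⟩), k4⟩
    · exact len0 _ k1 k0 k2
    · exact len1 _ _ k1 k3 k2
    · exact len1 _ _ k1 k4 k2
    · exact len2 _ _ _ k1 k4 k3 k2
    · exact len1 _ _ k1 k1' k2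
    · exact len2 _ _ _ k1 k1' k3 k2
    · exact len2 _ _ _ k1 k1' k4 k2
    · exact len3 _ _ _ _ k1 k1' k4 k3 k2
  have c := card_add_card_le_of_disjoint d
  have := h.large
  have := h.pos
  lia

/-- The out-neighbourhood of the sink of a transitive triangle contains a sink, even after
deleting two vertices. -/
lemma SixFree.exists_sink (hR : SixFree R) {a b c : V} (hab : R a b) (hbc : R b c) (hac : R a c)
    (u u' : V) : ∃ x, (R c x ∧ x ≠ u ∧ x ≠ u') ∧ ∀ y, R c y ∧ y ≠ u ∧ y ≠ u' → ¬ R x y := by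
  by_contra! hs
  obtain ⟨W, E, δ, h⟩ := hR.exists_env {a, b, c, u, u'} (card_le_five.trans (by norm_num))
  have hW : ∀ y ∈ W, a ≠ y ∧ b ≠ y ∧ c ≠ y ∧ u ≠ y ∧ u' ≠ y := by
    intro y hy
    refine ⟨?_, ?_, ?_, ?_, ?_⟩ <;> rintro rfl <;> exact h.avoid _ (by simp) hy
  have tri : ∀ x, R c x → x ∈ W → ∃ y z, R c y ∧ R c z ∧ R x y ∧ R y z ∧ R z x := by
    intro x hx hxW
    obtain ⟨y, hy, k1⟩ := hs x ⟨hx, (hW x hxW).2.2.2.1.symm, (hW x hxW).2.2.2.2.symm⟩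
    obtain ⟨z, hz, k2⟩ := hs y hy
    obtain ⟨w, hw, k3⟩ := hs z hz
    obtain rfl := hR.eq_of_path hx hy.1 hz.1 hw.1 k1 k2 k3
    exact ⟨y, z, hy.1, hz.1, k1, k2, k3⟩
  have ha : ∀ y, R c y → a ≠ y := by rintro y hy rfl; exact hR.asymm _ _ hac hy
  have hb : ∀ y, R c y → b ≠ y := by rintro y hy rfl; exact hR.asymm _ _ hbc hy
  have g := h.card_reach_inter hR (h.avoid c (by simp))
  have g1 := h.card_reach (h.reach_subset (X := outN R c ∩ W) inter_subset_right)
    ((h.nonempty (h.out_deg_inter c)).mono (subset_reach _ _))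
  have m := h.flip.card_reach_inter hR.flip (h.avoid a (by simp))
  have len0 : ∀ s, R c s → s ∈ W → R s a → False := by
    intro s k1 k2 k3
    obtain ⟨y, z, c1, c2, e1, e2, e3⟩ := tri s k1 k2
    exact hR.no_six a b c y z s hab hbc c1 e2 e3 k3 (ha _ c1) (hb _ c2) (hR.ne k1)
  have len1 : ∀ s t, R c s → E s t → R t a → False := by
    intro s t k1 k2 k3
    obtain ⟨y, z, c1, c2, e1, e2, e3⟩ := tri s k1 (h.left _ _ k2)
    exact hR.no_six a b c z s t hab hbc c2 e3 (h.sub _ _ k2) k3 (ha _ c2) (hb _ k1)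
      (hW t (h.right _ _ k2)).2.2.1
  have len2 : ∀ s t w, R c s → E s t → E t w → R w a → False := fun s t w k1 k2 k3 k4 =>
    hR.no_six a b c s t w hab hbc k1 (h.sub _ _ k2) (h.sub _ _ k3) k4 (ha _ k1)
      (hW t (h.right _ _ k2)).2.1 (hW w (h.right _ _ k3)).2.2.1
  have len3 : ∀ s t w w', R c s → E s t → E t w → E w w' → R w' a → False := by
    intro s t w w' k1 k2 k3 k4 k5
    refine hR.no_six a c s t w w' hac k1 (h.sub _ _ k2) (h.sub _ _ k3) (h.sub _ _ k4) k5
      (hW t (h.right _ _ k2)).1 (hW w (h.right _ _ k3)).2.2.1 ?_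
    rintro rfl; exact h.clean.no_three _ _ _ k2 k3 k4
  have d : Disjoint (reach E (reach E (outN R c ∩ W)))
      (reach (_root_.flip E) (outN (_root_.flip R) a ∩ W)) := by
    rw [disjoint_left]
    intro t k2 k1
    simp only [mem_reach, mem_outN, mem_inter] at k1 k2
    rcases k1 with ⟨k1, -⟩ | ⟨s, ⟨k1, -⟩, k1'⟩ <;>
    rcases k2 with (⟨k2, k0⟩ | ⟨z, ⟨k2, -⟩, k3⟩) | ⟨y, (⟨k2, -⟩ | ⟨z, ⟨k2, -⟩, k3⟩), k4⟩
    · exact len0 _ k2 k0 k1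
    · exact len1 _ _ k2 k3 k1
    · exact len1 _ _ k2 k4 k1
    · exact len2 _ _ _ k2 k3 k4 k1
    · exact len1 _ _ k2 k1' k1
    · exact len2 _ _ _ k2 k3 k1' k1
    · exact len2 _ _ _ k2 k4 k1' k1
    · exact len3 _ _ _ _ k2 k3 k4 k1' k1
  have c := card_add_card_le_of_disjoint d
  have := h.large
  have := h.pos
  lia

end

section

variable {V : Type*}

/-- The vertex is the source of a transitive triangle. -/
def IsTransSource (R : V → V → Prop) (v : V) : Prop := ∃ p q, R v p ∧ R p q ∧ R v q

variable [Fintype V] {R E : V → V → Prop}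

lemma SixFree.exists_sink_of_chain (hR : SixFree R) {v₁ u₁ v₂ u₂ v₃ : V} (a₂ : R u₁ v₂)
    (a₃ : R v₁ v₂) (b₁ : R v₂ u₂) (b₂ : R u₂ v₃) (b₃ : R v₂ v₃) :
    ∃ x, R v₃ x ∧ x ≠ v₁ ∧ (∀ y, R v₃ y → y ≠ v₁ → ¬ R x y) ∧
      ¬ (x = u₁ ∧ R u₁ u₂ ∧ R u₂ v₁) := by
  obtain ⟨x, ⟨hx, hx1, -⟩, hs⟩ := hR.exists_sink b₁ b₂ b₃ v₁ v₁
  by_cases hbad : x = u₁ ∧ R u₁ u₂ ∧ R u₂ v₁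
  · obtain ⟨x', ⟨hx', hx1', hx2'⟩, hs'⟩ := hR.exists_sink b₁ b₂ b₃ v₁ u₁
    refine ⟨x', hx', hx1', fun y hy hy1 hxy => ?_, fun hb => hx2' hb.1⟩
    by_cases hyu : y = u₁
    · subst hyu
      exact hR.no_six v₃ x' y u₂ v₁ v₂ hx' hxy hbad.2.1 hbad.2.2 a₃ b₃ (hR.ne b₂).symm hx1'
        (hR.ne a₂)
    · exact hs' y ⟨hy, hy1, hyu⟩ hxy
  · exact ⟨x, hx, hx1, fun y hy hy1 => hs y ⟨hy, hy1, hy1⟩, hbad⟩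

/-- No vertex is both the sink and the source of transitive triangles. -/
lemma SixFree.not_chain (hR : SixFree R) {v₁ u₁ v₂ u₂ v₃ : V} (a₁ : R v₁ u₁) (a₂ : R u₁ v₂)
    (a₃ : R v₁ v₂) (b₁ : R v₂ u₂) (b₂ : R u₂ v₃) (b₃ : R v₂ v₃) : False := by
  have ne' : ∀ {a b c}, R a b → R b c → a ≠ c := by
    rintro a b c h1 h2 rfl; exact hR.asymm _ _ h1 h2
  obtain ⟨x, hx, hxv, hxs, hxb⟩ := hR.exists_sink_of_chain a₂ a₃ b₁ b₂ b₃
  obtain ⟨z, hz, hzv, hzs, hzb⟩ :=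
    hR.flip.exists_sink_of_chain (v₁ := v₃) (u₁ := u₂) (v₂ := v₂) (u₂ := u₁) (v₃ := v₁)
      b₁ b₃ a₂ a₁ a₃
  simp only [_root_.flip] at hz hzs hzb
  have hAZ : ∀ t, R v₃ t → ¬ R t v₁ := fun t h1 h2 =>
    hR.no_six v₁ u₁ v₂ u₂ v₃ t a₁ a₂ b₁ b₂ h1 h2 (ne' a₃ b₁) (ne' a₂ b₃) (ne' b₃ h1)
  have d1 : Disjoint (outN R v₃) (inN R v₁) := by
    rw [disjoint_left]; intro t h1 h2; exact hAZ t (mem_outN.1 h1) (mem_inN.1 h2)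
  have d2 : Disjoint (outN R v₃ ∪ inN R v₁) (outN R x ∪ inN R z) := by
    rw [disjoint_left]
    intro t h1 h2
    simp only [mem_union, mem_outN, mem_inN] at h1 h2
    rcases h1 with h1 | h1 <;> rcases h2 with h2 | h2
    · by_cases ht : t = v₁
      · subst ht; exact hAZ x hx h2
      · exact hxs t h1 ht h2
    · by_cases hu : z = u₂
      · subst hu
        by_cases ht : t = u₁
        · subst ht; exact hzb ⟨rfl, h2, h1⟩
        · exact hR.no_six v₁ u₁ v₂ v₃ t z a₁ a₂ b₃ h1 h2 hz (ne' a₃ b₃) (Ne.symm ht)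
            (ne' hz a₃).symm
      · exact hR.no_six v₁ v₂ u₂ v₃ t z a₃ b₁ b₂ h1 h2 hz (ne' a₃ b₃) (ne' b₃ h1)
          (Ne.symm hu)
    · by_cases hu : x = u₁
      · subst hu
        by_cases ht : t = u₂
        · subst ht; exact hxb ⟨rfl, h2, h1⟩
        · exact hR.no_six v₁ v₂ u₂ v₃ x t a₃ b₁ b₂ hx h2 h1 (ne' a₃ b₃) (ne' b₃ hx)
            (Ne.symm ht)
      · exact hR.no_six v₁ u₁ v₂ v₃ x t a₁ a₂ b₃ hx h2 h1 (ne' a₃ b₃) (Ne.symm hu)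
          (ne' h1 a₃).symm
    · by_cases ht : t = v₃
      · subst ht; exact hAZ z h2 hz
      · exact hzs t h1 ht h2
  have d3 : #(outN R x ∩ inN R z) ≤ 1 := by
    refine (card_le_card (t := {v₂}) fun t ht => ?_).trans (card_singleton _).le
    rw [mem_inter, mem_outN, mem_inN] at ht
    by_contra hne
    exact hR.no_six v₁ v₂ v₃ x t z a₃ b₃ hx ht.1 ht.2 hz hxv.symm
      (fun h => hne (mem_singleton.2 h.symm)) hzv.symm
  have c := card_add_card_le_of_disjoint d2
  rw [card_union_of_disjoint d1] at c
  have c' := card_union_add_card_inter (outN R x) (inN R z)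
  have := hR.out_deg v₃
  have := hR.out_deg x
  have := hR.in_deg v₁
  have := hR.in_deg z
  lia

lemma SixFree.not_transSource_flip (hR : SixFree R) {v : V} (h : IsTransSource R v) :
    ¬ IsTransSource (_root_.flip R) v := by
  obtain ⟨p, q, h1, h2, h3⟩ := h
  rintro ⟨p', q', h1', h2', h3'⟩
  exact hR.not_chain h2' h1' h3' h1 h2 h3

/-- Edges which are not heavy lie in transitive triangles. -/
lemma SixFree.exists_common_in (hR : SixFree R) {u w : V} (huw : R u w) (hH : ¬ Heavy R u w)
    (hO : ¬ IsTransSource R u) : ∃ t, R t u ∧ R t w := by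
  by_contra! hcon
  refine hH ⟨huw, fun x => ?_⟩
  by_contra! hx
  have d1 : Disjoint (outN R u) (inN R w ∪ (inN R u ∪ outN R w)) := by
    rw [disjoint_left]
    intro t h1 h2
    simp only [mem_union, mem_outN, mem_inN] at h1 h2
    rcases h2 with h2 | h2 | h2
    · exact hO ⟨t, w, h1, h2, huw⟩
    · exact hR.asymm _ _ h1 h2
    · exact hO ⟨w, t, huw, h2, h1⟩
  have d2 : Disjoint (inN R w) (inN R u ∪ outN R w) := by
    rw [disjoint_left]
    intro t h1 h2
    simp only [mem_union, mem_outN, mem_inN] at h1 h2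
    rcases h2 with h2 | h2
    · exact hcon t h2 h1
    · exact hR.asymm _ _ h1 h2
  have d3 : #(inN R u ∩ outN R w) ≤ 1 := by
    refine (card_le_card (t := {x}) fun t ht => ?_).trans (card_singleton _).le
    rw [mem_inter, mem_outN, mem_inN] at ht
    by_contra hne
    exact hx t (fun h => hne (mem_singleton.2 h)) ht.2 ht.1
  have c := card_add_card_le_of_disjoint d1
  rw [card_union_of_disjoint d2] at c
  have c' := card_union_add_card_inter (inN R u) (outN R w)
  have := hR.out_deg u
  have := hR.out_deg w
  have := hR.in_deg u
  have := hR.in_deg w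
  lia

end

section

variable {V : Type*} [Fintype V]

lemma card_add_card_le_card_inter_add {X P₀ P₁ P₂ P₃ : Finset V} (h₀₁ : Disjoint P₀ P₁)
    (h₀₂ : Disjoint P₀ P₂) (h₀₃ : Disjoint P₀ P₃) (h₁₂ : Disjoint P₁ P₂) (h₁₃ : Disjoint P₁ P₃)
    (h₂₃ : Disjoint P₂ P₃) (hX : ∀ y ∈ X, y ∉ P₁ ∧ y ∉ P₂ ∧ y ∉ P₃) :
    #X + #P₀ + #P₁ + #P₂ + #P₃ ≤ #(X ∩ P₀) + Fintype.card V := by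
  have hX' : Disjoint X (P₁ ∪ P₂ ∪ P₃) := by
    rw [disjoint_left]; intro y h1 h2
    have := hX y h1
    simp only [mem_union] at h2
    tauto
  have c := card_add_card_le_of_disjoint (disjoint_union_left.2 ⟨hX',
    disjoint_union_right.2 ⟨disjoint_union_right.2 ⟨h₀₁, h₀₂⟩, h₀₃⟩⟩)
  rw [card_union_of_disjoint (disjoint_union_left.2 ⟨h₁₃, h₂₃⟩), card_union_of_disjoint h₁₂] at c
  have := card_union_add_card_inter X P₀
  lia

variable {R E : V → V → Prop} {F W : Finset V} {δ : ℕ}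

/-- A clean environment in which no vertex of `W` is the source of a transitive triangle. -/
structure SourceFree (R : V → V → Prop) (F W : Finset V) (E : V → V → Prop) (δ : ℕ) : Prop
    extends Env R F W E δ where
  sixFree : SixFree R
  not_source : ∀ v ∈ W, ¬ IsTransSource R v

lemma SourceFree.not_trans (h : SourceFree R F W E δ) {u p q : V} (h₁ : E u p) (h₂ : E p q) :
    ¬ E u q := fun h₃ =>
  h.not_source u (h.left _ _ h₁) ⟨p, q, h.sub _ _ h₁, h.sub _ _ h₂, h.sub _ _ h₃⟩

lemma SourceFree.exists_common_in (h : SourceFree R F W E δ) {u w : V} (huw : E u w) :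
    ∃ t, R t u ∧ R t w ∧ t ∉ W := by
  obtain ⟨t, h1, h2⟩ := h.sixFree.exists_common_in (h.sub _ _ huw) (h.not_heavy _ _ huw)
    (h.not_source u (h.left _ _ huw))
  exact ⟨t, h1, h2, fun ht => h.not_source t ht ⟨u, w, h1, h.sub _ _ huw, h2⟩⟩

lemma SourceFree.disjoint_inN_inN (h : SourceFree R F W E δ) {u w : V} (huw : E u w) :
    Disjoint (inN E u) (inN E w) := by
  rw [disjoint_left]; intro y h1 h2
  exact h.not_trans (mem_inN.1 h1) huw (mem_inN.1 h2)

lemma SourceFree.disjoint_outN_outN (h : SourceFree R F W E δ) {u w : V} (huw : E u w) :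
    Disjoint (outN E u) (outN E w) := by
  rw [disjoint_left]; intro y h1 h2
  exact h.not_trans huw (mem_outN.1 h2) (mem_outN.1 h1)

lemma SourceFree.disjoint_inN_outN (h : SourceFree R F W E δ) {u w : V} (huw : E u w) :
    Disjoint (inN E w) (outN E u) := by
  rw [disjoint_left]; intro y h1 h2
  exact h.not_trans (mem_outN.1 h2) (mem_inN.1 h1) huw

lemma Clean.disjoint_self {E : V → V → Prop} (h : Clean E) (u : V) :
    Disjoint (inN E u) (outN E u) := by
  rw [disjoint_left]; intro y h1 h2
  exact h.no_two _ _ (mem_inN.1 h1) (mem_outN.1 h2)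

lemma Clean.disjoint_inN_outN {E : V → V → Prop} (h : Clean E) {u w : V} (huw : E u w) :
    Disjoint (inN E u) (outN E w) := by
  rw [disjoint_left]; intro y h1 h2
  exact h.no_three _ _ _ (mem_inN.1 h1) huw (mem_outN.1 h2)

lemma SourceFree.card_add_le_out (h : SourceFree R F W E δ) {u w : V} (huw : E u w)
    {X : Finset V} (hX : ∀ y ∈ X, ¬ E y u ∧ ¬ E y w ∧ ¬ E u y) :
    #X + 4 * δ ≤ #(X ∩ outN E w) + Fintype.card V := by
  have c := card_add_card_le_card_inter_add (X := X) (h.clean.disjoint_inN_outN huw).symm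
    (h.clean.disjoint_self w).symm (h.disjoint_outN_outN huw).symm (h.disjoint_inN_inN huw)
    (h.clean.disjoint_self u) (h.disjoint_inN_outN huw) (by simpa using hX)
  have := h.in_deg u (h.left _ _ huw)
  have := h.out_deg u (h.left _ _ huw)
  have := h.in_deg w (h.right _ _ huw)
  have := h.out_deg w (h.right _ _ huw)
  lia

lemma SourceFree.card_outN_add_le (h : SourceFree R F W E δ) {u w : V} (huw : E u w) :
    #(outN E u) + #(outN E w) + 2 * δ ≤ Fintype.card V := by
  have c := card_add_card_le_card_inter_add (X := ∅) (h.clean.disjoint_inN_outN huw).symm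
    (h.clean.disjoint_self w).symm (h.disjoint_outN_outN huw).symm (h.disjoint_inN_inN huw)
    (h.clean.disjoint_self u) (h.disjoint_inN_outN huw) (by simp)
  rw [empty_inter, card_empty] at c
  have := h.in_deg u (h.left _ _ huw)
  have := h.in_deg w (h.right _ _ huw)
  lia

/-- Every edge lies in the middle of a closed walk of length four. -/
lemma SourceFree.exists_closed_four (h : SourceFree R F W E δ) {u w : V} (huw : E u w) :
    ∃ x y, E w x ∧ E x y ∧ E y u := by
  by_contra! hcon
  have hu := h.left _ _ huw
  have hw := h.right _ _ huw
  obtain ⟨x, hx⟩ := h.nonempty (h.out_deg w hw)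
  obtain ⟨y, hy⟩ := h.nonempty (h.in_deg u hu)
  rw [mem_outN] at hx
  rw [mem_inN] at hy
  have b0 := h.in_deg u hu
  have b1 := h.in_deg w hw
  have b2 := h.out_deg u hu
  have b3 := h.out_deg w hw
  have e₀₁ := h.disjoint_inN_inN huw
  have e₀₂ := h.clean.disjoint_self u
  have e₀₃ := h.clean.disjoint_inN_outN huw
  have e₁₂ := h.disjoint_inN_outN huw
  have e₁₃ := h.clean.disjoint_self w
  have e₂₃ := h.disjoint_outN_outN huw
  set S₂ := outN E x ∩ outN E u with hS₂
  set S₁ := inN E y ∩ inN E w with hS₁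
  have l₁ : S₁ ⊆ inN E w := inter_subset_right
  have l₂ : S₂ ⊆ outN E u := inter_subset_right
  have c2 : 5 * δ ≤ #S₂ + Fintype.card V := by
    have c := card_add_card_le_card_inter_add (X := outN E x) e₀₂.symm e₁₂.symm e₂₃
      e₀₁ e₀₃ e₁₃ (by
        intro s hs
        simp only [mem_inN, mem_outN] at hs ⊢
        exact ⟨hcon x s hx hs, h.clean.no_three _ _ _ hx hs, fun h' => h.not_trans hx hs h'⟩)
    have := h.out_deg x (h.right _ _ hx)
    lia
  have c1 : 5 * δ ≤ #S₁ + Fintype.card V := by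
    have c := card_add_card_le_card_inter_add (X := inN E y) e₀₁.symm e₁₂ e₁₃ e₀₂ e₀₃ e₂₃ (by
      intro s hs
      simp only [mem_inN, mem_outN] at hs ⊢
      exact ⟨h.not_trans hs hy, fun h' => h.clean.no_three _ _ _ h' hs hy,
        fun h' => hcon s y h' hs hy⟩)
    have := h.in_deg y (h.left _ _ hy)
    lia
  have k2 : ∀ s ∈ S₂, 9 * δ ≤ #(outN E s ∩ outN E w) + 2 * Fintype.card V := by
    intro s hs
    rw [hS₂, mem_inter, mem_outN, mem_outN] at hs
    have c := card_add_card_le_card_inter_add (X := outN E s) e₀₃.symm e₂₃.symm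
      (e₁₃.symm.mono_right l₁) e₀₂ (e₀₁.mono_right l₁) (e₁₂.symm.mono_right l₁) (by
        intro r hr
        simp only [hS₁, mem_inter, mem_inN, mem_outN] at hr ⊢
        exact ⟨h.clean.no_three _ _ _ hs.2 hr, fun h' => h.not_trans hs.2 hr h',
          fun h' => h.clean.no_six _ _ _ _ _ _ huw hx hs.1 hr h'.1 hy⟩)
    have := h.out_deg s (h.right _ _ hs.1)
    lia
  have k3 : ∀ s ∈ outN E w, 9 * δ ≤ #(outN E s ∩ S₂) + 2 * Fintype.card V := by
    intro s hs
    rw [mem_outN] at hs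
    have c := card_add_card_le_card_inter_add (X := outN E s) (e₀₂.symm.mono_left l₂)
      (e₁₂.symm.mono_left l₂) (e₂₃.mono_left l₂) e₀₁ e₀₃ e₁₃ (by
        intro r hr
        simp only [mem_inN, mem_outN] at hr ⊢
        exact ⟨hcon s r hs hr, h.clean.no_three _ _ _ hs hr, fun h' => h.not_trans hs hr h'⟩)
    have := h.out_deg s (h.right _ _ hs)
    lia
  obtain ⟨s, hs, hlow⟩ := h.clean.exists_low (S₂ ∪ outN E w) ⟨x, by simp [hx]⟩
  have c := card_union_le S₂ (outN E w)
  have c' := card_le_card l₂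
  have c'' := h.card_outN_add_le huw
  have i2 := card_le_card (inter_subset_inter_left (s := outN E s)
    (subset_union_left : S₂ ⊆ S₂ ∪ outN E w))
  have i3 := card_le_card (inter_subset_inter_left (s := outN E s)
    (subset_union_right : outN E w ⊆ S₂ ∪ outN E w))
  have := h.large
  have := h.pos
  rcases mem_union.1 hs with hs | hs
  · have := k2 s hs
    lia
  · have := k3 s hs
    lia

lemma SourceFree.card_outN_le (h : SourceFree R F W E δ) {u w : V} (huw : E u w) :
    #(outN E w) + 3 * δ ≤ Fintype.card V := by
  have := h.card_outN_add_le huw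
  have := h.out_deg u (h.left _ _ huw)
  lia

lemma SourceFree.not_edge_across (h : SourceFree R F W E δ) {u w x y : V} (huw : E u w)
    (hux : E u x) (hyw : E y w) : ¬ E x y := by
  intro hxy
  obtain ⟨p, q, h1, h2, h3⟩ := h.exists_closed_four huw
  exact h.clean.no_six _ _ _ _ _ _ hux hxy hyw h1 h2 h3

lemma SourceFree.false (h : SourceFree R F W E δ) {u w : V} (huw : E u w) : False := by
  have hL := h.large
  have hp := h.pos
  have hR := h.sixFree
  have hN := hR.large
  have trans : ∀ {a b t : V}, a ∈ W → R t b → E a b → ¬ R a t := fun ha h1 h2 h3 =>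
    h.not_source _ ha ⟨_, _, h3, h1, h.sub _ _ h2⟩
  obtain ⟨t, htu, htw, htW⟩ := h.exists_common_in huw
  obtain ⟨x, y, hwx, hxy, hyu⟩ := h.exists_closed_four huw
  have c := h.card_add_le_out huw (X := inN R t ∩ W) (by
    intro z hz
    rw [mem_inter, mem_inN] at hz
    exact ⟨fun h' => trans hz.2 htu h' hz.1, fun h' => trans hz.2 htw h' hz.1,
      fun h' => h.not_closed hR htW htw hwx hxy hyu h' hz.1⟩)
  have c' := h.in_deg_inter t
  obtain ⟨w', hw'⟩ : (inN R t ∩ W ∩ outN E w).Nonempty := by rw [← card_pos]; lia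
  simp only [mem_inter, mem_inN, mem_outN] at hw'
  obtain ⟨⟨hw't, -⟩, hww'⟩ := hw'
  obtain ⟨t', ht'w, ht'w', ht'W⟩ := h.exists_common_in hww'
  have c₁ := h.card_add_le_out hww' (X := inN R t' ∩ W) (by
    intro z hz
    rw [mem_inter, mem_inN] at hz
    refine ⟨fun h' => trans hz.2 ht'w h' hz.1, fun h' => trans hz.2 ht'w' h' hz.1, fun h' => ?_⟩
    refine hR.no_six t u w z t' w' htu (h.sub _ _ huw) (h.sub _ _ h') hz.1 ht'w' hw't ?_ ?_
      (hR.ne (h.sub _ _ hww'))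
    · rintro rfl; exact htW hz.2
    · rintro rfl; exact ht'W (h.left _ _ huw))
  have c₁' := h.in_deg_inter t'
  have hw'W := h.right _ _ hww'
  have c₂ := h.out_deg w (h.right _ _ huw)
  obtain ⟨v, hv, hne⟩ := exists_mem_ne (s := outN E w) (by lia) w'
  rw [mem_outN] at hv
  have c₃ := h.card_add_le_out hww' (X := outN E v) (by
    intro z hz
    rw [mem_outN] at hz
    exact ⟨h.clean.no_three _ _ _ hv hz, fun h' => h.not_edge_across hww' hv h' hz,
      h.not_trans hv hz⟩)
  have c₃' := h.out_deg v (h.right _ _ hv)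
  have c₄ := h.card_outN_le hww'
  have c₅ := card_union_add_card_inter (inN R t' ∩ W ∩ outN E w') (outN E v ∩ outN E w')
  have c₆ := card_le_card (union_subset (inter_subset_right : inN R t' ∩ W ∩ outN E w' ⊆ _)
    (inter_subset_right : outN E v ∩ outN E w' ⊆ _))
  obtain ⟨z, hz⟩ : ((inN R t' ∩ W ∩ outN E w') ∩ (outN E v ∩ outN E w')).Nonempty := by
    rw [← card_pos]; lia
  simp only [mem_inter, mem_inN, mem_outN] at hz
  refine hR.no_six t w v z t' w' htw (h.sub _ _ hv) (h.sub _ _ hz.2.1) hz.1.1.1 ht'w' hw't ?_ ?_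
    hne
  · rintro rfl; exact htW hz.1.1.2
  · rintro rfl; exact ht'W (h.right _ _ huw)

lemma Env.sources_dichotomy (h : Env R F W E δ) (hR : SixFree R) :
    (∀ v ∈ W, ¬ IsTransSource R v) ∨ ∀ v ∈ W, IsTransSource R v := by
  have out_closed : ∀ x y, E x y → ¬ IsTransSource R x → ¬ IsTransSource R y := by
    intro x y hxy hx hy
    obtain ⟨t, h1, h2⟩ := hR.exists_common_in (h.sub _ _ hxy) (h.not_heavy _ _ hxy) hx
    exact hR.not_transSource_flip hy ⟨x, t, h.sub _ _ hxy, h1, h2⟩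
  by_contra! hcon
  obtain ⟨⟨a, ha, hOa⟩, b, hb, hOb⟩ := hcon
  obtain ⟨x, hx, hx'⟩ := h.clean.exists_low {v ∈ W | ¬ IsTransSource R v}
    ⟨b, mem_filter.2 ⟨hb, hOb⟩⟩
  obtain ⟨y, hy, hy'⟩ := h.clean.flip.exists_low {v ∈ W | IsTransSource R v}
    ⟨a, mem_filter.2 ⟨ha, hOa⟩⟩
  rw [mem_filter] at hx hy
  rw [inter_eq_left.2] at hx' hy'
  · have c := card_filter_add_card_filter_not (s := W) (IsTransSource R)
    have := card_le_univ W
    have := h.out_deg x hx.1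
    have : δ ≤ #(outN (_root_.flip E) y) := h.in_deg y hy.1
    have := h.large
    have := h.pos
    lia
  · intro z hz
    have hz : E z y := (mem_outN (E := _root_.flip E)).1 hz
    exact mem_filter.2 ⟨h.left _ _ hz, by_contra fun h' => out_closed _ _ hz h' hy.2⟩
  · intro z hz
    rw [mem_outN] at hz
    exact mem_filter.2 ⟨h.right _ _ hz, out_closed _ _ hz hx.2⟩

theorem SixFree.false (hR : SixFree R) : False := by
  obtain ⟨W, E, δ, h⟩ := hR.exists_env ∅ (by simp)
  obtain ⟨v⟩ : Nonempty V := Fintype.card_pos_iff.1 h.pos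
  obtain ⟨w, hw⟩ := h.nonempty (h.out_deg_inter v)
  have hw := (mem_inter.1 hw).2
  rcases h.sources_dichotomy hR with h1 | h1
  · obtain ⟨y, hy⟩ := h.nonempty (h.out_deg w hw)
    exact SourceFree.false ⟨h, hR, h1⟩ (mem_outN.1 hy)
  · obtain ⟨y, hy⟩ := h.nonempty (h.in_deg w hw)
    exact SourceFree.false ⟨h.flip, hR.flip, fun v hv => hR.not_transSource_flip (h1 v hv)⟩
      (mem_outN.1 hy)

end

section

lemma sixFree_of_semiDeg {n : ℕ} (hn : 1000000000 ≤ n) {E : Fin n → Fin n → Prop}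
    (hE : Oriented E) (hdeg : ∀ v, (n : ℝ) / 4 + 1 / 2 ≤ (semiDeg E v : ℝ))
    (hC : ¬ HasDiCycle E 6) : SixFree E where
  asymm := hE.2
  out_deg v := by
    have h : (n : ℝ) / 4 + 1 / 2 ≤ #(outN E v) := by
      refine (hdeg v).trans (Nat.cast_le.2 ((min_le_left _ _).trans_eq ?_))
      rw [outDeg, ← Set.ncard_coe_finset]
      congr; ext; simp
    rw [Fintype.card_fin]
    have : (n : ℝ) + 2 ≤ 4 * #(outN E v) := by linarith
    exact_mod_cast this
  in_deg v := by
    have h : (n : ℝ) / 4 + 1 / 2 ≤ #(inN E v) := by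
      refine (hdeg v).trans (Nat.cast_le.2 ((min_le_right _ _).trans_eq ?_))
      rw [inDeg, ← Set.ncard_coe_finset]
      congr; ext; simp
    rw [Fintype.card_fin]
    have : (n : ℝ) + 2 ≤ 4 * #(inN E v) := by linarith
    exact_mod_cast this
  no_six a b c d e f hab hbc hcd hde hef hfa had hbe hcf := by
    have adj : ∀ {x y}, E x y → x ≠ y := by rintro x y h rfl; exact hE.1 _ h
    have two : ∀ {x y z}, E x y → E y z → x ≠ z := by rintro x y z h h' rfl; exact hE.2 _ _ h h'
    refine hC ⟨(![a, b, c, d, e, f] : Fin 6 → Fin n), ?_, ?_⟩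
    · have := adj hab
      have := adj hbc
      have := adj hcd
      have := adj hde
      have := adj hef
      have := adj hfa
      have := two hab hbc
      have := two hbc hcd
      have := two hcd hde
      have := two hde hef
      have := two hef hfa
      have := two hfa hab
      clear hab hbc hcd hde hef hfa adj two hC
      change Function.Injective (![a, b, c, d, e, f] : Fin 6 → Fin n)
      intro i j hij
      fin_cases i <;> fin_cases j <;> simp_all
    · intro i
      change Fin 6 at i
      fin_cases i
      exacts [hab, hbc, hcd, hde, hef, hfa]
  large := by rwa [Fintype.card_fin]

end

end SemidegreeC6

/-- Every sufficiently large `C₆`-free oriented graph with minimum semidegree at least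
`n/4 + 1/2` contains no transitive triangle. -/
theorem no_transitive_triangle :
    ∃ n₀ : ℕ, ∀ n : ℕ, n₀ ≤ n → ∀ E : Fin n → Fin n → Prop, Oriented E →
      (∀ v, (n : ℝ) / 4 + 1 / 2 ≤ (semiDeg E v : ℝ)) →
      ¬ HasDiCycle E 6 →
      ¬ ∃ a b c : Fin n, a ≠ b ∧ a ≠ c ∧ b ≠ c ∧ E a b ∧ E b c ∧ E a c := by
  refine ⟨1000000000, fun n hn E hE hdeg hC _ => ?_⟩
  exact (SemidegreeC6.sixFree_of_semiDeg hn hE hdeg hC).false
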